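/- arXiv:0802.0722 — 3 statements merged into one kernel-verified Lean document; each statement's English description precedes it below -/
import Mathlib

section
/- For each k=1,…,m there exist polynomials l_{k,1},…,l_{k,k} with deg l_{k,j} ≤ deg(p_{j+1}⋯p_k) − 1 for j < k and l_{k,k} ≡ 1, such that s̃_k = p₁ l_{k,1} s₁ + p₁p₂ l_{k,2} s₂ + ⋯ + (p₁⋯p_k) l_{k,k} s_k; that is, for every bounded Borel function f on ℝ, ∫ f(x) ds̃_k(x) = Σ_{j=1}^k ∫ f(x) (p₁⋯p_j)(x) l_{k,j}(x) ds_j(x). -/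
open MeasureTheory Polynomial Filter Set Metric

/-- The (closed) support of a Borel measure on `ℝ`. -/
def msupport (μ : MeasureTheory.Measure ℝ) : Set ℝ :=
  {x | ∀ ε > 0, 0 < μ (Metric.ball x ε)}

/-- The smallest closed interval containing the support of `μ`. -/
noncomputable def ihull (μ : MeasureTheory.Measure ℝ) : Set ℝ :=
  Set.Icc (sInf (msupport μ)) (sSup (msupport μ))

/-- The support of a measure viewed inside `ℂ`. -/
def csupp (μ : MeasureTheory.Measure ℝ) : Set ℂ :=
  Complex.ofReal '' msupport μ

/-- Density (with respect to `μ a`) of the Nikishin measure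
`⟨w_a μ_a, w_{a+1} μ_{a+1}, …, w_{a+r} μ_{a+r}⟩`:  for `r = 0` it is just the weight `w a`,
and inductively it is `w a` times the Cauchy transform of the inner system. -/
noncomputable def nikD (μ : ℕ → MeasureTheory.Measure ℝ) (w : ℕ → ℝ → ℂ) : ℕ → ℕ → ℝ → ℂ
  | a, 0 => w a
  | a, r + 1 => fun x =>
      w a x * ∫ t, nikD μ w (a + 1) r t / ((x : ℂ) - (t : ℂ)) ∂(μ (a + 1))

/-- Integral of `f` against the `k`-th measure (0-indexed) of the Nikishin system generated
by the weighted measures `w_j μ_j`. -/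
noncomputable def nikInt (μ : ℕ → MeasureTheory.Measure ℝ) (w : ℕ → ℝ → ℂ) (k : ℕ)
    (f : ℝ → ℂ) : ℂ :=
  ∫ x, f x * nikD μ w 0 k x ∂(μ 0)

/-- The multiple orthogonality relations for the multi-index `n` (0-indexed). -/
def OrthRel (μ : ℕ → MeasureTheory.Measure ℝ) (w : ℕ → ℝ → ℂ) (m : ℕ) (n : ℕ → ℕ)
    (Q : Polynomial ℂ) : Prop :=
  ∀ k < m, ∀ ν < n k, nikInt μ w k (fun x => (x : ℂ) ^ ν * Q.eval (x : ℂ)) = 0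

/-- `Q` is a monic multiple orthogonal polynomial of smallest degree for the Nikishin system
generated by the weighted measures `w_j μ_j` and the multi-index `n`. -/
def IsLeastMOP (μ : ℕ → MeasureTheory.Measure ℝ) (w : ℕ → ℝ → ℂ) (m : ℕ) (n : ℕ → ℕ)
    (Q : Polynomial ℂ) : Prop :=
  Q.Monic ∧ OrthRel μ w m n Q ∧
    ∀ Q' : Polynomial ℂ, Q'.Monic → OrthRel μ w m n Q' → Q.natDegree ≤ Q'.natDegree

/-- The second type functions: `psiFun μ w Q 0 = Q` and
`psiFun μ w Q (k+1) z = ∫ psiFun μ w Q k (x) · w k x / (z - x) dμ_k(x)`. -/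
noncomputable def psiFun (μ : ℕ → MeasureTheory.Measure ℝ) (w : ℕ → ℝ → ℂ)
    (Q : Polynomial ℂ) : ℕ → ℂ → ℂ
  | 0 => fun z => Q.eval z
  | k + 1 => fun z => ∫ x, psiFun μ w Q k (x : ℂ) * w k x / (z - (x : ℂ)) ∂(μ k)

/-- A system of `m` finite Borel measures with compact support on `ℝ`, each of constant
sign (`ς k ∈ {1,-1}`), whose interval hulls `Δ_k` are consecutively disjoint:
the generator of a Nikishin system. -/
structure NikSys (m : ℕ) where
  μ : ℕ → MeasureTheory.Measure ℝ
  ς : ℕ → ℝ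
  hsign : ∀ k < m, ς k = 1 ∨ ς k = -1
  hfin : ∀ k < m, MeasureTheory.IsFiniteMeasure (μ k)
  hcpt : ∀ k < m, IsCompact (msupport (μ k))
  hne : ∀ k < m, (msupport (μ k)).Nonempty
  hdisj : ∀ k, k + 1 < m → ihull (μ k) ∩ ihull (μ (k + 1)) = ∅

/-- The weights of the unperturbed system: just the signs. -/
def NikSys.w {m : ℕ} (S : NikSys m) : ℕ → ℝ → ℂ := fun k _ => (S.ς k : ℂ)

/-- The weights of the system perturbed by the polynomials `p`. -/
noncomputable def polyW {m : ℕ} (S : NikSys m) (p : ℕ → Polynomial ℂ) : ℕ → ℝ → ℂ :=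
  fun k x => (S.ς k : ℂ) * (p k).eval (x : ℂ)

/-- The weights of the system perturbed by the rational functions `p/q`. -/
noncomputable def ratW {m : ℕ} (S : NikSys m) (p q : ℕ → Polynomial ℂ) : ℕ → ℝ → ℂ :=
  fun k x => (S.ς k : ℂ) * (p k).eval (x : ℂ) / (q k).eval (x : ℂ)

/-- Monic polynomials whose zeros lie in `ℂ ∖ ⋃_{k<m} Δ_k`. -/
def GoodPolys (m : ℕ) (S : NikSys m) (p : ℕ → Polynomial ℂ) : Prop :=
  (∀ k < m, (p k).Monic) ∧
    ∀ k < m, ∀ z : ℂ, (p k).IsRoot z → ∀ i < m, z ∉ Complex.ofReal '' ihull (S.μ i)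

/-- A Nikishin generator of class `N^*`: the support of `σ_k` consists of an interval
`Δ̃_k = [a_k, b_k]` on which `|σ_k'| > 0` a.e., together with a discrete set without
accumulation points in `ℝ ∖ Δ̃_k`. -/
structure NikStar (m : ℕ) extends NikSys m where
  a : ℕ → ℝ
  b : ℕ → ℝ
  hab : ∀ k < m, a k < b k
  hsub : ∀ k < m, Set.Icc (a k) (b k) ⊆ msupport (μ k)
  hdisc : ∀ k < m, ∀ x ∉ Set.Icc (a k) (b k),
    ¬ AccPt x (Filter.principal (msupport (μ k)))
  hac : ∀ k < m,
    ∀ᵐ x ∂(MeasureTheory.volume.restrict (Set.Icc (a k) (b k))),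
      0 < (μ k).rnDeriv MeasureTheory.volume x

/-- The multi-index class `ℤ₊^m(⊛; p₁,…,p_m)` (0-indexed). -/
def StarIdx (m : ℕ) (p : ℕ → Polynomial ℂ) (n : ℕ → ℕ) : Prop :=
  (∀ k, m ≤ k → n k = 0) ∧
    ∀ j k : ℕ, j < k → k < m →
      n k + ∑ i ∈ Finset.Ioc j k, (p i).natDegree ≤ n j + 1

/-- The multi-index class `ℤ₊^m(⊛)` (0-indexed). -/
def CircIdx (m : ℕ) (n : ℕ → ℕ) : Prop :=
  (∀ k, m ≤ k → n k = 0) ∧ ∀ j k : ℕ, j < k → k < m → n k ≤ n j + 1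

/-- `|n| = n₁ + ⋯ + n_m`. -/
def mnorm (m : ℕ) (n : ℕ → ℕ) : ℕ := ∑ k ∈ Finset.range m, n k

/-- Uniform convergence, on every compact subset of `U`, of the functions `f n`
to `F` as `|n| → ∞` through `Λ`. -/
def UnifLimOn (m : ℕ) (Λ : Set ((ℕ → ℕ))) (f : (ℕ → ℕ) → ℂ → ℂ) (F : ℂ → ℂ)
    (U : Set ℂ) : Prop :=
  ∀ K : Set ℂ, K ⊆ U → IsCompact K → ∀ ε > 0, ∃ N : ℕ, ∀ n ∈ Λ, N ≤ mnorm m n →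
    ∀ z ∈ K, dist (f n z) (F z) < ε

/-- `F` is analytic and nowhere vanishing on `U` and has a finite nonzero limit at `∞`. -/
def GoodLimit (F : ℂ → ℂ) (U : Set ℂ) : Prop :=
  DifferentiableOn ℂ F U ∧ (∀ z ∈ U, F z ≠ 0) ∧
    ∃ c : ℂ, c ≠ 0 ∧ Filter.Tendsto F (Bornology.cobounded ℂ) (nhds c)

theorem measure_compl_msupport (μ : Measure ℝ) : μ (msupport μ)ᶜ = 0 := by
  refine measure_null_of_locally_null _ fun x hx => ?_
  simp only [msupport, mem_compl_iff, mem_ofPred_eq, not_forall, not_lt, nonpos_iff_eq_zero] at hx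
  obtain ⟨ε, hε, h⟩ := hx
  exact ⟨ball x ε, mem_nhdsWithin_of_mem_nhds (ball_mem_nhds x hε), h⟩

theorem NikSys.ae_mem_ihull {m : ℕ} (S : NikSys m) {k : ℕ} (hk : k < m) :
    ∀ᵐ x ∂(S.μ k), x ∈ ihull (S.μ k) := by
  have h : ∀ᵐ x ∂(S.μ k), x ∈ msupport (S.μ k) := measure_compl_msupport (S.μ k)
  filter_upwards [h] with x hx
  exact ⟨csInf_le (S.hcpt k hk).bddBelow hx, le_csSup (S.hcpt k hk).bddAbove hx⟩

theorem NikSys.exists_le_norm_sub {m : ℕ} (S : NikSys m) {k : ℕ} (hk : k + 1 < m) :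
    ∃ δ > 0, ∀ x ∈ ihull (S.μ k), ∀ t ∈ ihull (S.μ (k + 1)), δ ≤ ‖(x : ℂ) - (t : ℂ)‖ := by
  obtain ⟨δ, hδ, h⟩ := (Set.disjoint_iff_inter_eq_empty.2 (S.hdisj k hk)).exists_thickenings
    isCompact_Icc isClosed_Icc
  refine ⟨δ, hδ, fun x hx t ht => ?_⟩
  by_contra! hlt
  rw [← Complex.ofReal_sub, Complex.norm_real, ← dist_eq_norm] at hlt
  exact Set.disjoint_left.1 h (mem_thickening_iff.2 ⟨x, hx, by rwa [dist_comm]⟩)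
    (self_subset_thickening hδ _ ht)

theorem NikSys.measurable_nikD {m : ℕ} (S : NikSys m) (r : ℕ) :
    ∀ a, a + r < m → Measurable (nikD S.μ S.w a r) := by
  induction r with
  | zero => exact fun a _ => measurable_const
  | succ r ih =>
    intro a ha
    have := S.hfin (a + 1) (by omega)
    have hm := ih (a + 1) (by omega)
    have h : StronglyMeasurable (fun q : ℝ × ℝ =>
        nikD S.μ S.w (a + 1) r q.2 / ((q.1 : ℂ) - (q.2 : ℂ))) := by
      apply Measurable.stronglyMeasurable
      fun_prop
    exact measurable_const.mul h.integral_prod_right.measurable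

theorem NikSys.exists_norm_nikD_le {m : ℕ} (S : NikSys m) (r : ℕ) :
    ∀ a, a + r < m → ∃ C, ∀ x ∈ ihull (S.μ a), ‖nikD S.μ S.w a r x‖ ≤ C := by
  induction r with
  | zero => exact fun a _ => ⟨‖(S.ς a : ℂ)‖, fun x _ => le_rfl⟩
  | succ r ih =>
    intro a ha
    have := S.hfin (a + 1) (by omega)
    obtain ⟨C, hC⟩ := ih (a + 1) (by omega)
    obtain ⟨δ, hδ, hd⟩ := S.exists_le_norm_sub (k := a) (by omega)
    refine ⟨‖(S.ς a : ℂ)‖ * (C / δ * (S.μ (a + 1)).real univ), fun x hx => ?_⟩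
    simp only [nikD, NikSys.w, norm_mul]
    refine mul_le_mul_of_nonneg_left (norm_integral_le_of_norm_le_const ?_) (norm_nonneg _)
    filter_upwards [S.ae_mem_ihull (k := a + 1) (by omega)] with t ht
    rw [norm_div]
    exact div_le_div₀ ((norm_nonneg _).trans (hC t ht)) (hC t ht) hδ (hd x hx t ht)

theorem NikSys.integrable_of_bound {m : ℕ} (S : NikSys m) {k : ℕ} (hk : k < m) {g : ℝ → ℂ}
    (hg : Measurable g) {C : ℝ} (hC : ∀ x ∈ ihull (S.μ k), ‖g x‖ ≤ C) :
    Integrable g (S.μ k) := by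
  have := S.hfin k hk
  exact Integrable.of_bound hg.aestronglyMeasurable C
    ((S.ae_mem_ihull hk).mono fun x hx => hC x hx)

theorem NikSys.integrable_mul_nikD {m : ℕ} (S : NikSys m) {a r : ℕ} (har : a + r < m)
    {g : ℝ → ℂ} (hg : Measurable g) {C : ℝ} (hC : ∀ x ∈ ihull (S.μ a), ‖g x‖ ≤ C) :
    Integrable (fun x => g x * nikD S.μ S.w a r x) (S.μ a) := by
  obtain ⟨B, hB⟩ := S.exists_norm_nikD_le r a har
  refine S.integrable_of_bound (C := C * B) (by omega) (hg.mul (S.measurable_nikD r a har))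
    fun x hx => ?_
  rw [norm_mul]
  exact mul_le_mul (hC x hx) (hB x hx) (norm_nonneg _) ((norm_nonneg _).trans (hC x hx))

theorem exists_norm_eval_le_ihull (μ : Measure ℝ) (P : Polynomial ℂ) :
    ∃ C, ∀ x ∈ ihull μ, ‖P.eval (x : ℂ)‖ ≤ C :=
  isCompact_Icc.exists_bound_of_continuousOn (f := fun x : ℝ => P.eval (x : ℂ))
    (by fun_prop)

theorem NikSys.integrable_eval_mul_nikD {m : ℕ} (S : NikSys m) {a r : ℕ} (har : a + r < m)
    (P : Polynomial ℂ) :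
    Integrable (fun t : ℝ => P.eval (t : ℂ) * nikD S.μ S.w a r t) (S.μ a) := by
  obtain ⟨C, hC⟩ := exists_norm_eval_le_ihull (S.μ a) P
  exact S.integrable_mul_nikD har (by fun_prop) hC

theorem NikSys.integrable_eval_mul_nikD_div {m : ℕ} (S : NikSys m) {a r : ℕ}
    (har : a + 1 + r < m) (P : Polynomial ℂ) {x : ℝ} (hx : x ∈ ihull (S.μ a)) :
    Integrable (fun t : ℝ => P.eval (t : ℂ) * nikD S.μ S.w (a + 1) r t / ((x : ℂ) - t))
      (S.μ (a + 1)) := by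
  obtain ⟨C, hC⟩ := exists_norm_eval_le_ihull (S.μ (a + 1)) P
  obtain ⟨δ, hδ, hd⟩ := S.exists_le_norm_sub (k := a) (by omega)
  have h := S.integrable_mul_nikD har (g := fun t : ℝ => P.eval (t : ℂ) / ((x : ℂ) - t))
    (C := C / δ) (by fun_prop) fun t ht => by
      rw [norm_div]
      exact div_le_div₀ ((norm_nonneg _).trans (hC t ht)) (hC t ht) hδ (hd x hx t ht)
  refine h.congr (ae_of_all _ fun t => ?_)
  simp only
  ring

/-- Pulling a polynomial out of a Cauchy transform leaves a polynomial of smaller degree. -/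
theorem exists_integral_eval_mul_div_eq {μ : Measure ℝ} {g : ℝ → ℂ} {K : Set ℝ}
    (hK : ∀ x ∈ K, ∀ᵐ t : ℝ ∂μ, (x : ℂ) - (t : ℂ) ≠ 0)
    (hg : ∀ Q : Polynomial ℂ, Integrable (fun t : ℝ => Q.eval (t : ℂ) * g t) μ)
    (hgK : ∀ Q : Polynomial ℂ, ∀ x ∈ K,
      Integrable (fun t : ℝ => Q.eval (t : ℂ) * g t / ((x : ℂ) - t)) μ) (N : ℕ) :
    ∀ P : Polynomial ℂ, P.natDegree ≤ N → ∃ R : Polynomial ℂ, R.degree < (N : ℕ) ∧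
      ∀ x ∈ K, ∫ t, P.eval (t : ℂ) * g t / ((x : ℂ) - t) ∂μ =
        P.eval (x : ℂ) * ∫ t, g t / ((x : ℂ) - t) ∂μ - R.eval (x : ℂ) := by
  induction N with
  | zero =>
    intro P hP
    rw [eq_C_of_natDegree_le_zero hP]
    refine ⟨0, by simp, fun x _ => ?_⟩
    simp only [eval_C, eval_zero, sub_zero, mul_div_assoc, integral_const_mul]
  | succ N ih =>
    intro P hP
    obtain ⟨R, hR, h⟩ := ih P.divX (by rw [natDegree_divX_eq_natDegree_tsub_one]; omega)
    refine ⟨X * R + C (∫ t, P.divX.eval (t : ℂ) * g t ∂μ), ?_, fun x hx => ?_⟩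
    · refine (degree_add_le _ _).trans_lt (max_lt ?_ (degree_C_le.trans_lt ?_))
      · rw [mul_comm, degree_mul_X, Nat.cast_add, Nat.cast_one]
        by_cases h0 : R = 0
        · rw [h0, degree_zero, WithBot.bot_add]
          exact WithBot.bot_lt_coe (N + 1)
        · rw [degree_eq_natDegree h0] at hR ⊢
          exact_mod_cast Nat.succ_lt_succ (Nat.cast_lt.1 hR)
      · exact_mod_cast Nat.succ_pos N
    · have hev (y : ℂ) : P.eval y = P.divX.eval y * y + P.coeff 0 := by
        conv_lhs => rw [← divX_mul_X_add P]
        simp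
      have hi := hgK 1 x hx
      simp only [eval_one, one_mul] at hi
      have key : ∫ t, P.eval (t : ℂ) * g t / ((x : ℂ) - t) ∂μ =
          ∫ t, ((x : ℂ) * (P.divX.eval (t : ℂ) * g t / ((x : ℂ) - t))
            - P.divX.eval (t : ℂ) * g t) + P.coeff 0 * (g t / ((x : ℂ) - t)) ∂μ := by
        refine integral_congr_ae ((hK x hx).mono fun t ht => ?_)
        simp only [hev]
        field_simp
        ring
      have hi₁ := (hgK P.divX x hx).const_mul (x : ℂ)
      rw [key, integral_add (by exact hi₁.sub (hg _)) (hi.const_mul _),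
        integral_sub hi₁ (hg _), integral_const_mul, integral_const_mul,
        h x hx, hev x]
      simp only [eval_add, eval_mul, eval_X, eval_C]
      ring

theorem NikSys.exists_nikD_polyW_eq {m : ℕ} (S : NikSys m) (p : ℕ → Polynomial ℂ) (r : ℕ) :
    ∀ a, a + r < m → ∃ l : ℕ → Polynomial ℂ, l r = 1 ∧
      (∀ j < r, (l j).degree < (∑ i ∈ Finset.Ioc j r, (p (a + i)).natDegree : ℕ)) ∧
      ∀ x ∈ ihull (S.μ a), nikD S.μ (polyW S p) a r x =
        ∑ j ∈ Finset.range (r + 1), (∏ i ∈ Finset.range (j + 1), p (a + i)).eval (x : ℂ) *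
          (l j).eval (x : ℂ) * nikD S.μ S.w a j x := by
  induction r with
  | zero =>
    refine fun a _ => ⟨fun _ => 1, rfl, by simp, fun x _ => ?_⟩
    simp [nikD, polyW, NikSys.w, mul_comm]
  | succ r ih =>
    intro a ha
    obtain ⟨l, hl, hdeg, heq⟩ := ih (a + 1) (by omega)
    let P : ℕ → Polynomial ℂ := fun j => (∏ i ∈ Finset.range (j + 1), p (a + 1 + i)) * l j
    have hshift (j : ℕ) : ∑ i ∈ Finset.Ioc (j + 1) (r + 1), (p (a + i)).natDegree =
        ∑ i ∈ Finset.Ioc j r, (p (a + 1 + i)).natDegree := by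
      rw [← Finset.map_add_right_Ioc, Finset.sum_map]
      exact Finset.sum_congr rfl fun i _ => by simp only [addRightEmbedding_apply]; congr 2; ring
    have hP (j : ℕ) (hj : j ≤ r) :
        (P j).natDegree ≤ ∑ i ∈ Finset.Ioc 0 (r + 1), (p (a + i)).natDegree := by
      have htot : ∑ i ∈ Finset.Ioc 0 (r + 1), (p (a + i)).natDegree =
          ∑ i ∈ Finset.range (j + 1), (p (a + 1 + i)).natDegree +
            ∑ i ∈ Finset.Ioc j r, (p (a + 1 + i)).natDegree := by
        rw [← hshift, ← Finset.sum_Ioc_consecutive _ (Nat.zero_le (j + 1)) (by omega)]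
        congr 1
        rw [← Finset.Ico_add_one_add_one_eq_Ioc, Finset.sum_Ico_eq_sum_range]
        exact Finset.sum_congr rfl fun i _ => by congr 2; ring
      rw [htot]
      refine natDegree_mul_le.trans (add_le_add (natDegree_prod_le _ _) ?_)
      rcases hj.lt_or_eq with hj | rfl
      · exact natDegree_le_of_degree_le (hdeg j hj).le
      · simp [hl]
    have hR : ∀ j, ∃ R : Polynomial ℂ, j ≤ r →
        R.degree < (∑ i ∈ Finset.Ioc 0 (r + 1), (p (a + i)).natDegree : ℕ) ∧
        ∀ x ∈ ihull (S.μ a),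
          ∫ t, (P j).eval (t : ℂ) * nikD S.μ S.w (a + 1) j t / ((x : ℂ) - t) ∂(S.μ (a + 1)) =
          (P j).eval (x : ℂ) * ∫ t, nikD S.μ S.w (a + 1) j t / ((x : ℂ) - t) ∂(S.μ (a + 1))
            - R.eval (x : ℂ) := by
      intro j
      by_cases hj : j ≤ r
      · obtain ⟨δ, hδ, hd⟩ := S.exists_le_norm_sub (k := a) (by omega)
        obtain ⟨R, hR⟩ := exists_integral_eval_mul_div_eq (K := ihull (S.μ a))
          (g := nikD S.μ S.w (a + 1) j)
          (fun x hx => (S.ae_mem_ihull (k := a + 1) (by omega)).mono fun t ht =>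
            norm_pos_iff.1 (hδ.trans_le (hd x hx t ht)))
          (S.integrable_eval_mul_nikD (by omega))
          (fun Q x hx => S.integrable_eval_mul_nikD_div (by omega) Q hx) _ _ (hP j hj)
        exact ⟨R, fun _ => hR⟩
      · exact ⟨0, fun h => absurd h hj⟩
    choose R hR using hR
    refine ⟨fun j => Nat.casesOn j (-∑ j ∈ Finset.range (r + 1), R j) l, hl, ?_, fun x hx => ?_⟩
    · rintro (_ | j) hj
      · change (-∑ j ∈ Finset.range (r + 1), R j).degree < _
        rw [degree_neg]
        refine (degree_sum_le _ _).trans_lt ((Finset.sup_lt_iff (WithBot.bot_lt_coe _)).2 ?_)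
        exact fun j hj => (hR j (by simpa [Nat.lt_succ_iff] using hj)).1
      · rw [hshift]
        exact hdeg j (by omega)
    · have hint : ∫ t, nikD S.μ (polyW S p) (a + 1) r t / ((x : ℂ) - t) ∂(S.μ (a + 1)) =
          ∑ j ∈ Finset.range (r + 1), ((P j).eval (x : ℂ) *
            ∫ t, nikD S.μ S.w (a + 1) j t / ((x : ℂ) - t) ∂(S.μ (a + 1)) - (R j).eval (x : ℂ)) := by
        have hle {j : ℕ} (hj : j ∈ Finset.range (r + 1)) : j ≤ r :=
          Nat.lt_succ_iff.1 (Finset.mem_range.1 hj)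
        rw [← Finset.sum_congr rfl fun j hj => (hR j (hle hj)).2 x hx, ← integral_finsetSum _
          fun j hj => S.integrable_eval_mul_nikD_div (by have := hle hj; omega) _ hx]
        refine integral_congr_ae ((S.ae_mem_ihull (k := a + 1) (by omega)).mono fun t ht => ?_)
        simp only [heq t ht, Finset.sum_div, P, eval_mul]
      rw [Finset.sum_range_succ']
      simp only [nikD, hint, Finset.prod_range_succ' _ (_ + 1), eval_mul,
        Finset.sum_sub_distrib, polyW, NikSys.w, P, mul_sub, Finset.mul_sum]
      rw [sub_eq_add_neg]
      congr 1
      · refine Finset.sum_congr rfl fun j _ => ?_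
        simp only [add_zero, add_right_comm a _ 1, ← add_assoc]
        ring
      · simp [eval_finsetSum, Finset.mul_sum, mul_comm, mul_left_comm]
        exact Finset.sum_congr rfl fun j _ => by ring

/-- For each `k < m` there are polynomials `l_j` with
`deg l_j ≤ deg(p_{j+1}⋯p_k) - 1` for `j < k` and `l_k = 1` such that
`s̃_k = ∑_j (p₁⋯p_j) l_j s_j`, as an identity of integrals of bounded Borel functions. -/
theorem nikishin_perturbed_decomposition
    (m : ℕ) (hm : 0 < m) (S : NikSys m) (p : ℕ → Polynomial ℂ)
    (hp : GoodPolys m S p) (k : ℕ) (hk : k < m) :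
    ∃ l : ℕ → Polynomial ℂ, l k = 1 ∧
      (∀ j < k, (l j).degree < (∑ i ∈ Finset.Ioc j k, (p i).natDegree : ℕ)) ∧
      ∀ f : ℝ → ℂ, Measurable f → (∃ C : ℝ, ∀ x : ℝ, ‖f x‖ ≤ C) →
        nikInt S.μ (polyW S p) k f =
          ∑ j ∈ Finset.range (k + 1),
            nikInt S.μ S.w j
              (fun x => f x * (∏ i ∈ Finset.range (j + 1), p i).eval (x : ℂ) *
                (l j).eval (x : ℂ)) := by
  obtain ⟨l, hl, hdeg, heq⟩ := S.exists_nikD_polyW_eq p k 0 (by omega)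
  simp only [zero_add] at hdeg heq
  refine ⟨l, hl, hdeg, fun f hf ⟨C, hC⟩ => ?_⟩
  simp only [nikInt]
  rw [← integral_finsetSum]
  · refine integral_congr_ae ((S.ae_mem_ihull hm).mono fun x hx => ?_)
    simp only [heq x hx, Finset.mul_sum]
    exact Finset.sum_congr rfl fun j _ => by ring
  · intro j hj
    obtain ⟨B, hB⟩ := exists_norm_eval_le_ihull (S.μ 0)
      ((∏ i ∈ Finset.range (j + 1), p i) * l j)
    refine S.integrable_mul_nikD (C := C * B) (by have := Finset.mem_range.1 hj; omega)
      (by fun_prop) fun x hx => ?_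
    rw [mul_assoc, ← eval_mul, norm_mul]
    exact mul_le_mul (hC x) (hB x hx) (norm_nonneg _) ((norm_nonneg _).trans (hC x))
end

section
/- If n = (n₁,…,n_m) ∈ ℤ₊^m(⊛;p₁,…,p_m), then for each k = 1,…,m and ν = 0,…,n_k − 1, one has ∫ x^ν Q̃_n(x) (p₁⋯p_k)(x) ds_k(x) = 0. -/
open MeasureTheory Polynomial Filter Set Metric

/-- Functions integrable against `ν` together with their products with bounded functions:
measurable and bounded on the support of `ν`. -/
def BoundedOnSupport (ν : MeasureTheory.Measure ℝ) (g : ℝ → ℂ) : Prop :=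
  StronglyMeasurable g ∧ ∃ C : ℝ, ∀ x ∈ msupport ν, ‖g x‖ ≤ C

theorem ae_mem_msupport (ν : MeasureTheory.Measure ℝ) : ∀ᵐ x ∂ν, x ∈ msupport ν := by
  have h : msupport ν = ν.support := by
    ext x
    exact (Metric.nhds_basis_ball.mem_measureSupport).symm
  rw [h]
  exact Measure.support_mem_ae

theorem BoundedOnSupport.integrable {ν : MeasureTheory.Measure ℝ} [IsFiniteMeasure ν]
    {g : ℝ → ℂ} (hg : BoundedOnSupport ν g) : Integrable g ν := by
  obtain ⟨hm, C, hC⟩ := hg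
  exact Integrable.of_bound hm.aestronglyMeasurable C
    ((ae_mem_msupport ν).mono fun x hx => hC x hx)

theorem BoundedOnSupport.mul {ν : MeasureTheory.Measure ℝ} {f g : ℝ → ℂ}
    (hf : BoundedOnSupport ν f) (hg : BoundedOnSupport ν g) :
    BoundedOnSupport ν (fun x => f x * g x) := by
  obtain ⟨hfm, C, hC⟩ := hf
  obtain ⟨hgm, D, hD⟩ := hg
  refine ⟨hfm.mul hgm, C * D, fun x hx => ?_⟩
  rw [norm_mul]
  exact mul_le_mul (hC x hx) (hD x hx) (norm_nonneg _) ((norm_nonneg _).trans (hC x hx))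

theorem Continuous.boundedOnSupport {ν : MeasureTheory.Measure ℝ} (hν : IsCompact (msupport ν))
    {g : ℝ → ℂ} (hg : Continuous g) : BoundedOnSupport ν g :=
  ⟨hg.stronglyMeasurable, hν.exists_bound_of_continuousOn hg.continuousOn⟩

theorem boundedOnSupport_eval {ν : MeasureTheory.Measure ℝ} (hν : IsCompact (msupport ν))
    (P : ℂ[X]) : BoundedOnSupport ν (fun x => P.eval (x : ℂ)) :=
  Continuous.boundedOnSupport hν (by fun_prop)

theorem msupport_subset_ihull {ν : MeasureTheory.Measure ℝ} (hν : IsCompact (msupport ν)) :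
    msupport ν ⊆ ihull ν :=
  fun _ hx => ⟨csInf_le hν.bddBelow hx, le_csSup hν.bddAbove hx⟩

namespace NikSys

variable {m : ℕ} (S : NikSys m)

theorem ne_of_mem_msupport {a : ℕ} (ha : a + 1 < m) {x t : ℝ} (hx : x ∈ msupport (S.μ a))
    (ht : t ∈ msupport (S.μ (a + 1))) : x ≠ t := by
  rintro rfl
  have h : x ∈ ihull (S.μ a) ∩ ihull (S.μ (a + 1)) :=
    ⟨msupport_subset_ihull (S.hcpt a (by omega)) hx, msupport_subset_ihull (S.hcpt _ ha) ht⟩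
  rw [S.hdisj a ha] at h
  exact h

theorem exists_cauchyKernel_bound {a : ℕ} (ha : a + 1 < m) :
    ∃ C : ℝ, ∀ x ∈ msupport (S.μ a), ∀ t ∈ msupport (S.μ (a + 1)),
      ‖((x : ℂ) - (t : ℂ))⁻¹‖ ≤ C := by
  obtain ⟨C, hC⟩ := ((S.hcpt a (by omega)).prod (S.hcpt _ ha)).exists_bound_of_continuousOn
    (f := fun q : ℝ × ℝ => ((q.1 : ℂ) - (q.2 : ℂ))⁻¹) (by
      refine ContinuousOn.inv₀ (by fun_prop) ?_
      rintro ⟨x, t⟩ ⟨hx, ht⟩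
      rw [sub_ne_zero]
      exact_mod_cast S.ne_of_mem_msupport ha hx ht)
  exact ⟨C, fun x hx t ht => hC (x, t) ⟨hx, ht⟩⟩

theorem boundedOnSupport_cauchyKernel {a : ℕ} (ha : a + 1 < m) {x : ℝ}
    (hx : x ∈ msupport (S.μ a)) :
    BoundedOnSupport (S.μ (a + 1)) (fun t => ((x : ℂ) - (t : ℂ))⁻¹) := by
  obtain ⟨C, hC⟩ := S.exists_cauchyKernel_bound ha
  refine ⟨Measurable.stronglyMeasurable (by fun_prop), C, fun t ht => hC x hx t ht⟩

theorem integrable_div {a : ℕ} (ha : a + 1 < m) {x : ℝ} (hx : x ∈ msupport (S.μ a))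
    {f : ℝ → ℂ} (hf : BoundedOnSupport (S.μ (a + 1)) f) :
    Integrable (fun t => f t / ((x : ℂ) - (t : ℂ))) (S.μ (a + 1)) := by
  have := S.hfin _ ha
  simp only [div_eq_mul_inv]
  exact (hf.mul (S.boundedOnSupport_cauchyKernel ha hx)).integrable

theorem boundedOnSupport_integral_div {a : ℕ} (ha : a + 1 < m) {f : ℝ → ℂ}
    (hf : BoundedOnSupport (S.μ (a + 1)) f) :
    BoundedOnSupport (S.μ a) (fun x => ∫ t, f t / ((x : ℂ) - (t : ℂ)) ∂(S.μ (a + 1))) := by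
  have := S.hfin _ ha
  obtain ⟨K, hK⟩ := S.exists_cauchyKernel_bound ha
  obtain ⟨hfm, C, hC⟩ := hf
  constructor
  · refine StronglyMeasurable.integral_prod_right
      (f := fun x t : ℝ => f t / ((x : ℂ) - (t : ℂ))) ?_
    have h := hfm.measurable
    refine Measurable.stronglyMeasurable ?_
    simp only [Function.uncurry_def]
    fun_prop
  · refine ⟨C * K * (S.μ (a + 1)).real Set.univ, fun x hx => ?_⟩
    refine norm_integral_le_of_norm_le_const ((ae_mem_msupport _).mono fun t ht => ?_)
    rw [div_eq_mul_inv, norm_mul]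
    exact mul_le_mul (hC t ht) (hK x hx t ht) (norm_nonneg _)
      ((norm_nonneg _).trans (hC t ht))

theorem boundedOnSupport_nikD {w : ℕ → ℝ → ℂ} (hw : ∀ k, Continuous (w k)) (r a : ℕ)
    (ha : a + r < m) : BoundedOnSupport (S.μ a) (nikD S.μ w a r) := by
  induction r generalizing a with
  | zero => exact Continuous.boundedOnSupport (S.hcpt a ha) (hw a)
  | succ r ih =>
    exact (Continuous.boundedOnSupport (S.hcpt a (by omega)) (hw a)).mul
      (S.boundedOnSupport_integral_div (by omega) (ih (a + 1) (by omega)))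

/-- Moving a polynomial inside a Cauchy transform costs a polynomial of smaller degree. -/
theorem exists_eval_mul_integral_div {a : ℕ} (ha : a + 1 < m) {f : ℝ → ℂ}
    (hf : BoundedOnSupport (S.μ (a + 1)) f) (N : ℕ) (P : ℂ[X]) (hP : P.natDegree ≤ N) :
    ∃ R : ℂ[X], R.degree < N ∧ ∀ x ∈ msupport (S.μ a),
      P.eval (x : ℂ) * ∫ t, f t / ((x : ℂ) - (t : ℂ)) ∂(S.μ (a + 1)) =
        (∫ t, P.eval (t : ℂ) * f t / ((x : ℂ) - (t : ℂ)) ∂(S.μ (a + 1))) +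
          R.eval (x : ℂ) := by
  have := S.hfin _ ha
  induction N generalizing P with
  | zero =>
    refine ⟨0, by simp, fun x _ => ?_⟩
    rw [Polynomial.eq_C_of_natDegree_le_zero hP]
    simp only [eval_C, mul_div_assoc, integral_const_mul, eval_zero, add_zero]
  | succ N ih =>
    obtain ⟨R, hR, h⟩ := ih P.divX (by rw [natDegree_divX_eq_natDegree_tsub_one]; omega)
    set c : ℂ := ∫ t, P.divX.eval (t : ℂ) * f t ∂(S.μ (a + 1)) with hc
    refine ⟨R * X + C c, ?_, fun x hx => ?_⟩
    · refine (degree_add_le _ _).trans_lt (max_lt ?_ (degree_C_le.trans_lt (by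
        exact_mod_cast N.succ_pos)))
      rw [degree_mul_X]
      by_cases h0 : R = 0
      · simp [h0]
      · rw [degree_eq_natDegree h0] at hR ⊢
        exact_mod_cast Nat.succ_lt_succ (by exact_mod_cast hR)
    · have hPf := (boundedOnSupport_eval (S.hcpt _ ha) P.divX).mul hf
      have i0 := S.integrable_div ha hx hf
      have i1 := S.integrable_div ha hx hPf
      have i2 : Integrable (fun t : ℝ => (x : ℂ) * (P.divX.eval (t : ℂ) * f t /
          ((x : ℂ) - (t : ℂ))) - P.divX.eval (t : ℂ) * f t) (S.μ (a + 1)) :=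
        (i1.const_mul _).sub hPf.integrable
      have key : ∫ t, P.eval (t : ℂ) * f t / ((x : ℂ) - (t : ℂ)) ∂(S.μ (a + 1)) =
          ∫ t, ((x : ℂ) * (P.divX.eval (t : ℂ) * f t / ((x : ℂ) - (t : ℂ))) -
            P.divX.eval (t : ℂ) * f t) + P.coeff 0 * (f t / ((x : ℂ) - (t : ℂ)))
              ∂(S.μ (a + 1)) := by
        refine integral_congr_ae ((ae_mem_msupport _).mono fun t ht => ?_)
        have hne : (x : ℂ) - (t : ℂ) ≠ 0 := by
          rw [sub_ne_zero]
          exact_mod_cast S.ne_of_mem_msupport ha hx ht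
        have e : P.eval (t : ℂ) = P.divX.eval (t : ℂ) * t + P.coeff 0 := by
          conv_lhs => rw [← divX_mul_X_add P]
          simp
        simp only [e]
        field_simp
        ring
      have e : P.eval (x : ℂ) = P.divX.eval (x : ℂ) * x + P.coeff 0 := by
        conv_lhs => rw [← divX_mul_X_add P]
        simp
      rw [key, integral_add i2 (i0.const_mul _),
        integral_sub (i1.const_mul _) hPf.integrable, integral_const_mul, integral_const_mul,
        ← hc, e]
      simp only [eval_add, eval_mul, eval_X, eval_C]
      linear_combination (x : ℂ) * h x hx

theorem continuous_w (k : ℕ) : Continuous (S.w k) := continuous_const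

theorem continuous_polyW (p : ℕ → ℂ[X]) (k : ℕ) : Continuous (polyW S p k) := by
  unfold polyW
  fun_prop

/-- The unperturbed densities, multiplied by the perturbing polynomials, are polynomial
combinations of the perturbed ones. -/
theorem exists_prod_eval_mul_nikD (p : ℕ → ℂ[X]) (r a : ℕ) (ha : a + r < m) :
    ∃ l : ℕ → ℂ[X],
      (∀ j < r, (l j).degree <
        ((∑ i ∈ Finset.Ioc (a + j) (a + r), (p i).natDegree : ℕ) : WithBot ℕ)) ∧
      ∀ x ∈ msupport (S.μ a),
        (∏ i ∈ Finset.range (r + 1), p (a + i)).eval (x : ℂ) * nikD S.μ S.w a r x =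
          nikD S.μ (polyW S p) a r x +
            ∑ j ∈ Finset.range r, (l j).eval (x : ℂ) * nikD S.μ (polyW S p) a j x := by
  induction r generalizing a with
  | zero =>
    refine ⟨0, by simp, fun x _ => ?_⟩
    simp [nikD, polyW, NikSys.w, mul_comm]
  | succ r ih =>
    obtain ⟨l, hl, h⟩ := ih (a + 1) (by omega)
    set P : ℂ[X] := ∏ i ∈ Finset.range (r + 1), p (a + 1 + i) with hPdef
    set N : ℕ := ∑ i ∈ Finset.Ioc a (a + (r + 1)), (p i).natDegree with hN
    have ha1 : a + 1 < m := by omega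
    have hPN : P.natDegree ≤ N := by
      refine (natDegree_prod_le _ _).trans (le_of_eq ?_)
      rw [hN, ← Finset.Ico_add_one_add_one_eq_Ioc, Finset.sum_Ico_eq_sum_range]
      congr 2
      omega
    obtain ⟨R₀, hR₀, h₀⟩ := S.exists_eval_mul_integral_div ha1
      (S.boundedOnSupport_nikD S.continuous_w r (a + 1) (by omega)) N P hPN
    have hD : ∀ j ≤ r, BoundedOnSupport (S.μ (a + 1)) (nikD S.μ (polyW S p) (a + 1) j) :=
      fun j hj => S.boundedOnSupport_nikD (S.continuous_polyW p) j (a + 1) (by omega)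
    have hex : ∀ j, ∃ R : ℂ[X], j < r → R.degree < N ∧ ∀ x ∈ msupport (S.μ a),
        (l j).eval (x : ℂ) *
            ∫ t, nikD S.μ (polyW S p) (a + 1) j t / ((x : ℂ) - (t : ℂ)) ∂(S.μ (a + 1)) =
          (∫ t, (l j).eval (t : ℂ) * nikD S.μ (polyW S p) (a + 1) j t / ((x : ℂ) - (t : ℂ))
            ∂(S.μ (a + 1))) + R.eval (x : ℂ) := by
      intro j
      by_cases hj : j < r
      · have hsub : ∑ i ∈ Finset.Ioc (a + 1 + j) (a + 1 + r), (p i).natDegree ≤ N :=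
          Finset.sum_le_sum_of_subset (Finset.Ioc_subset_Ioc (by omega) (by omega))
        obtain ⟨R, hR⟩ := S.exists_eval_mul_integral_div ha1 (hD j hj.le) N (l j)
          ((natDegree_le_of_degree_le (hl j hj).le).trans hsub)
        exact ⟨R, fun _ => hR⟩
      · exact ⟨0, fun hj' => absurd hj' hj⟩
    choose R hR using hex
    refine ⟨fun j => Nat.casesOn j (R₀ - ∑ j ∈ Finset.range r, R j) l, ?_, fun x hx => ?_⟩
    · rintro (_ | j) hj
      · refine (degree_sub_le _ _).trans_lt (max_lt hR₀ ?_)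
        refine (degree_sum_le _ _).trans_lt ((Finset.sup_lt_iff (WithBot.bot_lt_coe N)).2 ?_)
        exact fun j hj => (hR j (Finset.mem_range.1 hj)).1
      · have := hl j (by omega)
        simpa only [add_assoc, add_comm 1] using this
    · have hint : ∫ t, P.eval (t : ℂ) * nikD S.μ S.w (a + 1) r t / ((x : ℂ) - (t : ℂ))
            ∂(S.μ (a + 1)) =
          (∫ t, nikD S.μ (polyW S p) (a + 1) r t / ((x : ℂ) - (t : ℂ)) ∂(S.μ (a + 1))) +
            ∑ j ∈ Finset.range r, ∫ t, (l j).eval (t : ℂ) *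
              nikD S.μ (polyW S p) (a + 1) j t / ((x : ℂ) - (t : ℂ)) ∂(S.μ (a + 1)) := by
        have hi : ∀ j ∈ Finset.range r, Integrable (fun t : ℝ => (l j).eval (t : ℂ) *
            nikD S.μ (polyW S p) (a + 1) j t / ((x : ℂ) - (t : ℂ))) (S.μ (a + 1)) :=
          fun j hj => S.integrable_div ha1 hx
            ((boundedOnSupport_eval (S.hcpt _ ha1) (l j)).mul
              (hD j (Finset.mem_range.1 hj).le))
        rw [← integral_finsetSum _ hi,
          ← integral_add (S.integrable_div ha1 hx (hD r le_rfl)) (integrable_finsetSum _ hi)]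
        refine integral_congr_ae ((ae_mem_msupport _).mono fun t ht => ?_)
        simp only [h t ht, add_div, Finset.sum_div]
      have hsum := Finset.sum_congr (rfl : Finset.range r = Finset.range r)
        fun j hj => (hR j (Finset.mem_range.1 hj)).2 x hx
      rw [Finset.sum_add_distrib] at hsum
      have hprod : ∏ i ∈ Finset.range (r + 1 + 1), p (a + i) = P * p a := by
        rw [Finset.prod_range_succ', hPdef]
        simp only [add_zero, add_assoc, add_comm 1]
      rw [hprod, Finset.sum_range_succ']
      simp only [nikD, eval_mul]
      have hfac : ∑ j ∈ Finset.range r, (l j).eval (x : ℂ) * (polyW S p a x *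
          ∫ t, nikD S.μ (polyW S p) (a + 1) j t / ((x : ℂ) - (t : ℂ)) ∂(S.μ (a + 1))) =
          polyW S p a x * ∑ j ∈ Finset.range r, (l j).eval (x : ℂ) *
          ∫ t, nikD S.μ (polyW S p) (a + 1) j t / ((x : ℂ) - (t : ℂ)) ∂(S.μ (a + 1)) := by
        rw [Finset.mul_sum]
        exact Finset.sum_congr rfl fun j _ => by ring
      have hw : polyW S p a x = S.w a x * (p a).eval (x : ℂ) := rfl
      have h₀x := h₀ x hx
      rw [hint] at h₀x
      rw [hfac, hsum, hw]
      change _ = _ + (_ + (R₀ - ∑ j ∈ Finset.range r, R j).eval (x : ℂ) * _)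
      rw [eval_sub, eval_finsetSum]
      linear_combination S.w a x * (p a).eval (x : ℂ) * h₀x

theorem integrable_eval_mul_nikD_s2 (p : ℕ → ℂ[X]) (P : ℂ[X]) {k : ℕ} (hk : k < m) :
    Integrable (fun x : ℝ => P.eval (x : ℂ) * nikD S.μ (polyW S p) 0 k x) (S.μ 0) := by
  have := S.hfin 0 (by omega)
  exact ((boundedOnSupport_eval (S.hcpt 0 (by omega)) P).mul
    (S.boundedOnSupport_nikD (S.continuous_polyW p) k 0 (by omega))).integrable

end NikSys

theorem OrthRel.integral_eval_mul {m : ℕ} {S : NikSys m} {p : ℕ → ℂ[X]} {n : ℕ → ℕ} {Q : ℂ[X]}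
    (hQ : OrthRel S.μ (polyW S p) m n Q) {k : ℕ} (hk : k < m) {q : ℂ[X]}
    (hq : q.degree < n k) :
    ∫ x, (q * Q).eval (x : ℂ) * nikD S.μ (polyW S p) 0 k x ∂(S.μ 0) = 0 := by
  by_cases h0 : q = 0
  · simp [h0]
  rw [degree_eq_natDegree h0, Nat.cast_lt] at hq
  have e : ∀ x : ℝ, (q * Q).eval (x : ℂ) * nikD S.μ (polyW S p) 0 k x =
      ∑ i ∈ Finset.range (q.natDegree + 1),
        q.coeff i * ((X ^ i * Q).eval (x : ℂ) * nikD S.μ (polyW S p) 0 k x) := by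
    intro x
    rw [eval_mul, eval_eq_sum_range, Finset.sum_mul, Finset.sum_mul]
    refine Finset.sum_congr rfl fun i _ => ?_
    simp only [eval_mul, eval_pow, eval_X]
    ring
  simp only [e]
  rw [integral_finsetSum _ fun i _ => (S.integrable_eval_mul_nikD_s2 p _ hk).const_mul _]
  refine Finset.sum_eq_zero fun i hi => ?_
  rw [integral_const_mul]
  have := hQ k hk i (by rw [Finset.mem_range] at hi; omega)
  simp only [nikInt] at this
  simp only [eval_mul, eval_pow, eval_X, this, mul_zero]

/-- If `n ∈ ℤ₊^m(⊛; p₁,…,p_m)` then for each `k` the perturbed multiple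
orthogonal polynomial `Q̃_n` satisfies
`∫ x^ν Q̃_n(x) (p₁⋯p_k)(x) ds_k(x) = 0` for `ν = 0, …, n_k - 1`. -/
theorem perturbed_MOP_orthogonality_initial_system
    (m : ℕ) (hm : 0 < m) (S : NikSys m) (p : ℕ → Polynomial ℂ) (hp : GoodPolys m S p)
    (n : ℕ → ℕ) (hn : StarIdx m p n)
    (Qt : Polynomial ℂ) (hQt : IsLeastMOP S.μ (polyW S p) m n Qt) :
    ∀ k < m, ∀ ν < n k,
      nikInt S.μ S.w k
        (fun x => (x : ℂ) ^ ν * Qt.eval (x : ℂ) *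
          (∏ i ∈ Finset.range (k + 1), p i).eval (x : ℂ)) = 0 := by
  intro k hk ν hν
  obtain ⟨l, hl, h⟩ := S.exists_prod_eval_mul_nikD p k 0 (by omega)
  simp only [zero_add] at hl h
  have e : nikInt S.μ S.w k (fun x => (x : ℂ) ^ ν * Qt.eval (x : ℂ) *
        (∏ i ∈ Finset.range (k + 1), p i).eval (x : ℂ)) =
      ∫ x, (X ^ ν * Qt).eval (x : ℂ) * nikD S.μ (polyW S p) 0 k x +
        ∑ j ∈ Finset.range k,
          (X ^ ν * l j * Qt).eval (x : ℂ) * nikD S.μ (polyW S p) 0 j x ∂(S.μ 0) := by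
    refine integral_congr_ae ((ae_mem_msupport _).mono fun x hx => ?_)
    simp only [mul_assoc, h x hx, eval_mul, eval_pow, eval_X, mul_add, Finset.mul_sum]
    refine congrArg₂ _ rfl (Finset.sum_congr rfl fun j _ => ?_)
    ring
  have hi : ∀ j ∈ Finset.range k, Integrable (fun x : ℝ =>
      (X ^ ν * l j * Qt).eval (x : ℂ) * nikD S.μ (polyW S p) 0 j x) (S.μ 0) :=
    fun j hj => S.integrable_eval_mul_nikD_s2 p _ ((Finset.mem_range.1 hj).trans hk)
  rw [e, integral_add (S.integrable_eval_mul_nikD_s2 p _ hk) (integrable_finsetSum _ hi),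
    integral_finsetSum _ hi,
    hQt.2.1.integral_eval_mul hk (by rw [degree_X_pow]; exact_mod_cast hν), zero_add]
  refine Finset.sum_eq_zero fun j hj => ?_
  rw [Finset.mem_range] at hj
  refine hQt.2.1.integral_eval_mul (hj.trans hk) ?_
  by_cases h0 : l j = 0
  · simp [h0]
  · have hlj := hl j hj
    have hnj := hn.2 j k hj hk
    rw [degree_eq_natDegree h0, Nat.cast_lt] at hlj
    rw [degree_mul, degree_X_pow, degree_eq_natDegree h0, ← Nat.cast_add, Nat.cast_lt]
    omega
end

section
/- Let n ∈ ℤ₊^m(⊛;p₁,…,p_m) with n_k ≥ deg(p_{k+1}⋯p_m) for all k, set R_n = Q̃_n·(p₁⋯p_m) and N = deg(p₁p₂²⋯p_m^m). Then there exist unique constants λ_{n,0},…,λ_{n,N} such that R_n = Σ_{j=0}^N λ_{n,j} Q_{n_j}. Moreover, if j′ is such that deg R_n = deg Q_{n_{j′}}, then λ_{n,j′} = 1 and λ_{n,j} = 0 for j′+1 ≤ j ≤ N; in particular, λ_{n,N} = 1 if and only if deg Q̃_n = |n|. -/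
open MeasureTheory Polynomial Filter Set Metric

/-- A measurable function which is bounded on the interval hull of the support of `μ`. -/
def BddOnHull (μ : MeasureTheory.Measure ℝ) (f : ℝ → ℂ) : Prop :=
  Measurable f ∧ ∃ C : ℝ, ∀ x ∈ ihull μ, ‖f x‖ ≤ C

lemma ae_mem_ihull {μ : MeasureTheory.Measure ℝ} (hc : IsCompact (msupport μ)) :
    ∀ᵐ x ∂μ, x ∈ ihull μ := by
  have h : msupport μ = μ.support := by
    ext x
    rw [Metric.nhds_basis_ball.mem_measureSupport]
    rfl
  have h2 : μ.support ∈ ae μ := Measure.support_mem_ae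
  rw [← h] at h2
  filter_upwards [h2] with x hx
  exact ⟨csInf_le hc.bddBelow hx, le_csSup hc.bddAbove hx⟩

namespace BddOnHull

variable {μ : MeasureTheory.Measure ℝ} {f g : ℝ → ℂ}

lemma mul (hf : BddOnHull μ f) (hg : BddOnHull μ g) : BddOnHull μ (fun x => f x * g x) := by
  obtain ⟨hfm, C, hC⟩ := hf
  obtain ⟨hgm, D, hD⟩ := hg
  refine ⟨hfm.mul hgm, C * D, fun x hx => ?_⟩
  rw [norm_mul]
  exact mul_le_mul (hC x hx) (hD x hx) (norm_nonneg _) ((norm_nonneg _).trans (hC x hx))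

lemma of_continuous (hf : Continuous f) : BddOnHull μ f := by
  refine ⟨hf.measurable, ?_⟩
  exact isCompact_Icc.exists_bound_of_continuousOn hf.continuousOn

lemma of_polynomial (P : Polynomial ℂ) : BddOnHull μ (fun x => P.eval (x : ℂ)) :=
  of_continuous (P.continuous.comp Complex.continuous_ofReal)

lemma integrable [IsFiniteMeasure μ] (hc : IsCompact (msupport μ)) (hf : BddOnHull μ f) :
    Integrable f μ := by
  obtain ⟨hfm, C, hC⟩ := hf
  refine Integrable.of_bound hfm.aestronglyMeasurable C ?_
  filter_upwards [ae_mem_ihull hc] with x hx using hC x hx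

lemma sub_ne_zero_of_notMem {x t : ℝ} (hx : x ∉ ihull μ) (ht : t ∈ ihull μ) :
    (x : ℂ) - (t : ℂ) ≠ 0 := by
  rw [sub_ne_zero]
  intro h
  exact hx (Complex.ofReal_injective h ▸ ht)

lemma div_sub (hf : BddOnHull μ f) {x : ℝ} (hx : x ∉ ihull μ) :
    BddOnHull μ (fun t => f t / ((x : ℂ) - (t : ℂ))) := by
  simp_rw [div_eq_mul_inv]
  refine hf.mul ⟨by fun_prop, ?_⟩
  refine isCompact_Icc.exists_bound_of_continuousOn ?_
  exact ContinuousOn.inv₀ (by fun_prop) fun t ht => sub_ne_zero_of_notMem hx ht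

lemma cauchy [IsFiniteMeasure μ] (hc : IsCompact (msupport μ)) (hf : BddOnHull μ f)
    {ν : MeasureTheory.Measure ℝ} (hd : ihull ν ∩ ihull μ = ∅) :
    BddOnHull ν (fun x => ∫ t, f t / ((x : ℂ) - (t : ℂ)) ∂μ) := by
  obtain ⟨hfm, C, hC⟩ := hf
  constructor
  · have hm : Measurable (fun q : ℝ × ℝ => f q.2 / ((q.1 : ℂ) - (q.2 : ℂ))) := by fun_prop
    exact (hm.stronglyMeasurable.integral_prod_right' (ν := μ)).measurable
  · obtain ⟨D, hD⟩ : ∃ D : ℝ, ∀ q ∈ ihull ν ×ˢ ihull μ, ‖((q.1 : ℂ) - (q.2 : ℂ))⁻¹‖ ≤ D := by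
      refine (isCompact_Icc.prod isCompact_Icc).exists_bound_of_continuousOn ?_
      refine ContinuousOn.inv₀ (by fun_prop) fun q hq => sub_ne_zero_of_notMem ?_ hq.2
      exact fun h => Set.eq_empty_iff_forall_notMem.1 hd _ ⟨hq.1, h⟩
    refine ⟨C * D * μ.real univ, fun x hx => norm_integral_le_of_norm_le_const ?_⟩
    filter_upwards [ae_mem_ihull hc] with t ht
    rw [div_eq_mul_inv, norm_mul]
    exact mul_le_mul (hC t ht) (hD (x, t) ⟨hx, ht⟩) (norm_nonneg _)
      ((norm_nonneg _).trans (hC t ht))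

/-- A polynomial can be moved inside a Cauchy transform up to a polynomial of lower degree:
the monomial case. -/
lemma exists_pow_mul_cauchy [IsFiniteMeasure μ] (hc : IsCompact (msupport μ))
    (hg : BddOnHull μ g) (d : ℕ) :
    ∃ A ∈ degreeLT ℂ d, ∀ x : ℝ, x ∉ ihull μ →
      (x : ℂ) ^ d * ∫ t, g t / ((x : ℂ) - (t : ℂ)) ∂μ =
        A.eval (x : ℂ) + ∫ t, (t : ℂ) ^ d * g t / ((x : ℂ) - (t : ℂ)) ∂μ := by
  induction d with
  | zero => exact ⟨0, Submodule.zero_mem _, fun x _ => by simp⟩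
  | succ d ih =>
    obtain ⟨A, hA, h⟩ := ih
    refine ⟨X * A + C (∫ t, (t : ℂ) ^ d * g t ∂μ), ?_, fun x hx => ?_⟩
    · rw [mem_degreeLT] at hA ⊢
      refine (degree_add_le _ _).trans_lt (max_lt ?_ ?_)
      · by_cases h0 : A = 0
        · simp [h0]
        · rw [degree_eq_natDegree h0] at hA
          rw [degree_mul, degree_X, degree_eq_natDegree h0]
          have hA' : A.natDegree < d := by exact_mod_cast hA
          have : 1 + A.natDegree < d + 1 := by omega
          exact_mod_cast this
      · exact degree_C_le.trans_lt (by exact_mod_cast Nat.succ_pos d)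
    · have hp : BddOnHull μ (fun t : ℝ => (t : ℂ) ^ d * g t) :=
        (of_continuous (by fun_prop)).mul hg
      rw [pow_succ', mul_assoc, h x hx, mul_add, ← integral_const_mul]
      have hi : ∫ t : ℝ, (x : ℂ) * ((t : ℂ) ^ d * g t / ((x : ℂ) - (t : ℂ))) ∂μ =
          ∫ t : ℝ, ((t : ℂ) ^ d * g t + (t : ℂ) ^ (d + 1) * g t / ((x : ℂ) - (t : ℂ))) ∂μ := by
        refine integral_congr_ae ?_
        filter_upwards [ae_mem_ihull hc] with t ht
        have := sub_ne_zero_of_notMem hx ht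
        field_simp
        ring
      have hp' : BddOnHull μ (fun t : ℝ => (t : ℂ) ^ (d + 1) * g t) :=
        (of_continuous (by fun_prop)).mul hg
      rw [hi, integral_add (hp.integrable hc) ((hp'.div_sub hx).integrable hc)]
      simp
      ring

/-- A polynomial can be moved inside a Cauchy transform up to a polynomial of lower degree. -/
lemma exists_eval_mul_cauchy [IsFiniteMeasure μ] (hc : IsCompact (msupport μ))
    (hg : BddOnHull μ g) (P : Polynomial ℂ) :
    ∃ A ∈ degreeLT ℂ P.natDegree, ∀ x : ℝ, x ∉ ihull μ →
      P.eval (x : ℂ) * ∫ t, g t / ((x : ℂ) - (t : ℂ)) ∂μ =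
        A.eval (x : ℂ) + ∫ t, P.eval (t : ℂ) * g t / ((x : ℂ) - (t : ℂ)) ∂μ := by
  choose A hA h using exists_pow_mul_cauchy hc hg
  refine ⟨∑ i ∈ Finset.range (P.natDegree + 1), P.coeff i • A i, ?_, fun x hx => ?_⟩
  · refine Submodule.sum_mem _ fun i hi => Submodule.smul_mem _ _ (degreeLT_mono ?_ (hA i))
    exact Nat.lt_succ_iff.1 (Finset.mem_range.1 hi)
  · have hi : ∀ i, Integrable
        (fun t : ℝ => P.coeff i * ((t : ℂ) ^ i * g t / ((x : ℂ) - (t : ℂ)))) μ := fun i =>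
      ((((of_continuous (by fun_prop)).mul hg).div_sub hx).integrable hc).const_mul _
    have hs : ∫ t, P.eval (t : ℂ) * g t / ((x : ℂ) - (t : ℂ)) ∂μ =
        ∑ i ∈ Finset.range (P.natDegree + 1),
          P.coeff i * ∫ t, (t : ℂ) ^ i * g t / ((x : ℂ) - (t : ℂ)) ∂μ := by
      simp_rw [← integral_const_mul]
      rw [← integral_finsetSum _ fun i _ => hi i]
      refine integral_congr_ae (Eventually.of_forall fun t => ?_)
      simp only [eval_eq_sum_range, Finset.sum_mul, Finset.sum_div]
      exact Finset.sum_congr rfl fun i _ => by ring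
    rw [hs, eval_eq_sum_range, eval_finsetSum, Finset.sum_mul, ← Finset.sum_add_distrib]
    refine Finset.sum_congr rfl fun i _ => ?_
    rw [mul_assoc, h i x hx, eval_smul, smul_eq_mul, mul_add]

end BddOnHull

lemma bddOnHull_nikD {m : ℕ} (S : NikSys m) {w : ℕ → ℝ → ℂ} (hw : ∀ k < m, Continuous (w k))
    (r : ℕ) : ∀ a, a + r < m → BddOnHull (S.μ a) (nikD S.μ w a r) := by
  induction r with
  | zero => exact fun a ha => BddOnHull.of_continuous (hw a ha)
  | succ r ih =>
    intro a ha
    have := S.hfin (a + 1) (by omega)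
    exact (BddOnHull.of_continuous (hw a (by omega))).mul
      ((ih (a + 1) (by omega)).cauchy (S.hcpt (a + 1) (by omega)) (S.hdisj a (by omega)))

/-- The densities of the unperturbed system, multiplied by the perturbing polynomials, are
combinations of the densities of the perturbed system with coefficients of small degree. -/
lemma exists_prod_mul_nikD {m : ℕ} (S : NikSys m) {w : ℕ → ℝ → ℂ}
    (hw : ∀ k < m, Continuous (w k)) (p : ℕ → Polynomial ℂ) {w' : ℕ → ℝ → ℂ}
    (hw' : ∀ k x, w' k x = w k x * (p k).eval (x : ℂ)) (r : ℕ) :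
    ∀ a, a + r < m → ∃ l : ℕ → Polynomial ℂ,
      (∀ i < r, l i ∈ degreeLT ℂ (∑ j ∈ Finset.Ioc (a + i) (a + r), (p j).natDegree)) ∧
      ∀ x ∈ ihull (S.μ a), (∏ j ∈ Finset.Icc a (a + r), p j).eval (x : ℂ) * nikD S.μ w a r x =
        ∑ i ∈ Finset.range r, (l i).eval (x : ℂ) * nikD S.μ w' a i x + nikD S.μ w' a r x := by
  have hwc : ∀ k < m, Continuous (w' k) := fun k hk => by
    have : w' k = fun x => w k x * (p k).eval (x : ℂ) := funext (hw' k)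
    rw [this]
    exact (hw k hk).mul ((p k).continuous.comp Complex.continuous_ofReal)
  induction r with
  | zero =>
    refine fun a _ => ⟨0, by simp, fun x _ => ?_⟩
    simp [nikD, hw', mul_comm]
  | succ r ih =>
    intro a ha
    obtain ⟨l, hl, hlx⟩ := ih (a + 1) (by omega)
    have := S.hfin (a + 1) (by omega)
    have hc := S.hcpt (a + 1) (by omega)
    have hg := bddOnHull_nikD S hw r (a + 1) (by omega)
    have hg' : ∀ i ≤ r, BddOnHull (S.μ (a + 1)) (nikD S.μ w' (a + 1) i) :=
      fun i hi => bddOnHull_nikD S hwc i (a + 1) (by omega)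
    set P := ∏ j ∈ Finset.Icc (a + 1) (a + 1 + r), p j with hP
    obtain ⟨A, hA, hAx⟩ := hg.exists_eval_mul_cauchy hc P
    have hB' : ∀ i : ℕ, ∃ B : Polynomial ℂ, i < r → B ∈ degreeLT ℂ (l i).natDegree ∧
        ∀ x : ℝ, x ∉ ihull (S.μ (a + 1)) →
        (l i).eval (x : ℂ) * ∫ t, nikD S.μ w' (a + 1) i t / ((x : ℂ) - (t : ℂ)) ∂(S.μ (a + 1)) =
        B.eval (x : ℂ) + ∫ t, (l i).eval (t : ℂ) * nikD S.μ w' (a + 1) i t /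
          ((x : ℂ) - (t : ℂ)) ∂(S.μ (a + 1)) := fun i => by
      by_cases hi : i < r
      · obtain ⟨B, h1, h2⟩ := (hg' i hi.le).exists_eval_mul_cauchy hc (l i)
        exact ⟨B, fun _ => ⟨h1, h2⟩⟩
      · exact ⟨0, fun h => absurd h hi⟩
    choose B hB using hB'
    obtain ⟨l', hl'0, hl's⟩ : ∃ l' : ℕ → Polynomial ℂ,
        l' 0 = A - ∑ i ∈ Finset.range r, B i ∧ ∀ i, l' (i + 1) = l i :=
      ⟨fun i => Nat.casesOn i (A - ∑ i ∈ Finset.range r, B i) l, rfl, fun _ => rfl⟩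
    refine ⟨l', ?_, fun x hx => ?_⟩
    · rintro (_ | i) hi
      · rw [hl'0]
        refine Submodule.sub_mem _ (degreeLT_mono ?_ hA) (Submodule.sum_mem _ fun i hi => ?_)
        · refine (natDegree_prod_le _ _).trans (le_of_eq ?_)
          refine Finset.sum_congr ?_ fun _ _ => rfl
          ext j
          simp only [Finset.mem_Icc, Finset.mem_Ioc]
          omega
        · rw [Finset.mem_range] at hi
          refine degreeLT_mono ?_ (hB i hi).1
          by_cases h0 : l i = 0
          · simp [h0]
          · have h1 := mem_degreeLT.1 (hl i hi)
            rw [← natDegree_lt_iff_degree_lt h0] at h1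
            refine h1.le.trans (Finset.sum_le_sum_of_subset fun j => ?_)
            simp only [Finset.mem_Ioc]
            omega
      · have h1 : a + (i + 1) = a + 1 + i := by ring
        have h2 : a + (r + 1) = a + 1 + r := by ring
        rw [h1, h2, hl's]
        exact hl i (by omega)
    · have hx' : x ∉ ihull (S.μ (a + 1)) := fun h =>
        Set.eq_empty_iff_forall_notMem.1 (S.hdisj a (by omega)) _ ⟨hx, h⟩
      have hint : ∀ f, BddOnHull (S.μ (a + 1)) f →
          Integrable (fun t => f t / ((x : ℂ) - (t : ℂ))) (S.μ (a + 1)) :=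
        fun f hf => (hf.div_sub hx').integrable hc
      have hI : ∫ t, P.eval (t : ℂ) * nikD S.μ w (a + 1) r t / ((x : ℂ) - (t : ℂ))
            ∂(S.μ (a + 1)) =
          ∑ i ∈ Finset.range r, ∫ t, (l i).eval (t : ℂ) * nikD S.μ w' (a + 1) i t /
            ((x : ℂ) - (t : ℂ)) ∂(S.μ (a + 1)) +
          ∫ t, nikD S.μ w' (a + 1) r t / ((x : ℂ) - (t : ℂ)) ∂(S.μ (a + 1)) := by
        have hi : ∀ i ∈ Finset.range r, Integrable (fun t : ℝ => (l i).eval (t : ℂ) *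
            nikD S.μ w' (a + 1) i t / ((x : ℂ) - (t : ℂ))) (S.μ (a + 1)) := fun i hi =>
          hint _ ((BddOnHull.of_polynomial (l i)).mul (hg' i (Finset.mem_range.1 hi).le))
        rw [← integral_finsetSum _ hi,
          ← integral_add (integrable_finsetSum _ hi) (hint _ (hg' r le_rfl))]
        refine integral_congr_ae ?_
        filter_upwards [ae_mem_ihull hc] with t ht
        rw [hP, hlx t ht, add_div, Finset.sum_div]
      have hsplit : ∏ j ∈ Finset.Icc a (a + (r + 1)), p j = p a * P := by
        rw [hP, ← Finset.insert_Icc_add_one_left_eq_Icc (by omega : a ≤ a + (r + 1)),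
          Finset.prod_insert (by simp)]
        congr 3
        ring
      have hsum : ∑ i ∈ Finset.range r, (l i).eval (x : ℂ) *
            ∫ t, nikD S.μ w' (a + 1) i t / ((x : ℂ) - (t : ℂ)) ∂(S.μ (a + 1)) =
          ∑ i ∈ Finset.range r, (B i).eval (x : ℂ) +
          ∑ i ∈ Finset.range r, ∫ t, (l i).eval (t : ℂ) * nikD S.μ w' (a + 1) i t /
            ((x : ℂ) - (t : ℂ)) ∂(S.μ (a + 1)) := by
        rw [← Finset.sum_add_distrib]
        exact Finset.sum_congr rfl fun i hi => (hB i (Finset.mem_range.1 hi)).2 x hx'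
      have h3 : ∑ i ∈ Finset.range r, (l i).eval (x : ℂ) * nikD S.μ w' a (i + 1) x =
          w' a x * ∑ i ∈ Finset.range r, (l i).eval (x : ℂ) *
            ∫ t, nikD S.μ w' (a + 1) i t / ((x : ℂ) - (t : ℂ)) ∂(S.μ (a + 1)) := by
        rw [Finset.mul_sum]
        exact Finset.sum_congr rfl fun i _ => by simp only [nikD]; ring
      have h4 := hAx x hx'
      rw [hI] at h4
      rw [Finset.sum_range_succ', hsplit, eval_mul]
      simp only [hl's, h3, hsum]
      simp only [nikD, hw', hl'0, eval_sub, eval_finsetSum]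
      linear_combination (w a x * (p a).eval (x : ℂ)) * h4

lemma exists_linearMap_nikInt {m : ℕ} (S : NikSys m) {w : ℕ → ℝ → ℂ}
    (hw : ∀ k < m, Continuous (w k)) {k : ℕ} (hk : k < m) :
    ∃ L : Polynomial ℂ →ₗ[ℂ] ℂ, ∀ f, L f = nikInt S.μ w k (fun x => f.eval (x : ℂ)) := by
  have := S.hfin 0 (by omega)
  have hi : ∀ f : Polynomial ℂ,
      Integrable (fun x : ℝ => f.eval (x : ℂ) * nikD S.μ w 0 k x) (S.μ 0) := fun f =>
    ((BddOnHull.of_polynomial f).mul (bddOnHull_nikD S hw k 0 (by omega))).integrable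
      (S.hcpt 0 (by omega))
  refine ⟨⟨⟨fun f => nikInt S.μ w k (fun x => f.eval (x : ℂ)), fun f g => ?_⟩, fun c f => ?_⟩,
    fun f => rfl⟩
  · simp only [nikInt, eval_add, add_mul]
    exact integral_add (hi f) (hi g)
  · simp only [nikInt, eval_smul, smul_eq_mul, mul_assoc, RingHom.id_apply]
    exact integral_const_mul _ _

/-- Orthogonality to powers of the variable implies orthogonality to polynomials. -/
lemma OrthRel.nikInt_mul_eq_zero {m : ℕ} {S : NikSys m} {w : ℕ → ℝ → ℂ}
    (hw : ∀ k < m, Continuous (w k)) {n : ℕ → ℕ} {Q : Polynomial ℂ}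
    (hQ : OrthRel S.μ w m n Q) {k : ℕ} (hk : k < m) {f : Polynomial ℂ}
    (hf : f ∈ degreeLT ℂ (n k)) :
    nikInt S.μ w k (fun x => (f * Q).eval (x : ℂ)) = 0 := by
  obtain ⟨L, hL⟩ := exists_linearMap_nikInt S hw hk
  have h : degreeLT ℂ (n k) ≤ LinearMap.ker (L ∘ₗ LinearMap.mulRight ℂ Q) := by
    rw [degreeLT_eq_span_X_pow, Submodule.span_le]
    intro g hg
    simp only [Finset.coe_image, Finset.coe_range, Set.mem_image, Set.mem_Iio] at hg
    obtain ⟨i, hi, rfl⟩ := hg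
    have := hQ k hk i hi
    simpa [hL] using this
  rw [← hL]
  exact h hf

lemma OrthRel.mono {m : ℕ} {μ : ℕ → MeasureTheory.Measure ℝ} {w : ℕ → ℝ → ℂ} {n n' : ℕ → ℕ}
    {Q : Polynomial ℂ} (hQ : OrthRel μ w m n Q) (h : ∀ k, n' k ≤ n k) : OrthRel μ w m n' Q :=
  fun k hk ν hν => hQ k hk ν (hν.trans_le (h k))

/-- The polynomials satisfying given orthogonality relations form a subspace. -/
lemma exists_submodule_orthRel {m : ℕ} (S : NikSys m) {w : ℕ → ℝ → ℂ}
    (hw : ∀ k < m, Continuous (w k)) (n : ℕ → ℕ) :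
    ∃ V : Submodule ℂ (Polynomial ℂ), ∀ Q, Q ∈ V ↔ OrthRel S.μ w m n Q := by
  choose L hL using fun k (hk : k < m) => exists_linearMap_nikInt S hw hk
  refine ⟨⨅ (k : ℕ) (hk : k < m) (ν : ℕ) (_ : ν < n k),
    LinearMap.ker (L k hk ∘ₗ LinearMap.mulLeft ℂ (X ^ ν)), fun Q => ?_⟩
  simp [Submodule.mem_iInf, hL, OrthRel]

/-- A least multiple orthogonal polynomial has degree at most `|n|`. -/
lemma IsLeastMOP.natDegree_le {m : ℕ} {S : NikSys m} {w : ℕ → ℝ → ℂ}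
    (hw : ∀ k < m, Continuous (w k)) {n : ℕ → ℕ} {Q : Polynomial ℂ}
    (hQ : IsLeastMOP S.μ w m n Q) : Q.natDegree ≤ mnorm m n := by
  choose L hL using fun k : Fin m => exists_linearMap_nikInt S hw k.2
  let T : degreeLT ℂ (mnorm m n + 1) →ₗ[ℂ] ((Σ k : Fin m, Fin (n k)) → ℂ) :=
    LinearMap.pi fun q =>
      (L q.1 ∘ₗ LinearMap.mulLeft ℂ (X ^ (q.2 : ℕ))) ∘ₗ (degreeLT ℂ (mnorm m n + 1)).subtype
  have hfr : Module.finrank ℂ (degreeLT ℂ (mnorm m n + 1)) = mnorm m n + 1 := by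
    rw [(degreeLTEquiv ℂ (mnorm m n + 1)).finrank_eq]
    simp
  have : FiniteDimensional ℂ (degreeLT ℂ (mnorm m n + 1)) :=
    (degreeLTEquiv ℂ (mnorm m n + 1)).symm.finiteDimensional
  have hker : LinearMap.ker T ≠ ⊥ := by
    refine LinearMap.ker_ne_bot_of_finrank_lt ?_
    rw [hfr, Module.finrank_fintype_fun_eq_card]
    simp [mnorm, Finset.sum_range]
  obtain ⟨f, hf, hf0⟩ := (Submodule.ne_bot_iff _).1 hker
  have hf0' : (f : Polynomial ℂ) ≠ 0 := by simpa using hf0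
  obtain ⟨V, hV⟩ := exists_submodule_orthRel S hw n
  have hfV : (f : Polynomial ℂ) ∈ V := by
    rw [hV]
    intro k hk ν hν
    have h := congrFun (LinearMap.mem_ker.1 hf) ⟨⟨k, hk⟩, ⟨ν, hν⟩⟩
    simpa [T, hL] using h
  have hmon : (C (f : Polynomial ℂ).leadingCoeff⁻¹ * (f : Polynomial ℂ)).Monic := by
    rw [mul_comm]
    exact monic_mul_leadingCoeff_inv hf0'
  have hle := hQ.2.2 _ hmon ((hV _).1 (by rw [← smul_eq_C_mul]; exact V.smul_mem _ hfV))
  refine hle.trans ((natDegree_C_mul_le _ _).trans ?_)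
  have := mem_degreeLT.1 f.2
  rw [← natDegree_lt_iff_degree_lt hf0'] at this
  omega

/-- Multiplication by the perturbing polynomials turns the orthogonality relations of the perturbed
system into those of the original system, for a smaller multi-index. -/
lemma OrthRel.mul_prod {m : ℕ} {S : NikSys m} {w : ℕ → ℝ → ℂ}
    (hw : ∀ k < m, Continuous (w k)) {p : ℕ → Polynomial ℂ} {w' : ℕ → ℝ → ℂ}
    (hw' : ∀ k x, w' k x = w k x * (p k).eval (x : ℂ)) {n : ℕ → ℕ} (hn : StarIdx m p n)
    {Q : Polynomial ℂ} (hQ : OrthRel S.μ w' m n Q) :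
    OrthRel S.μ w m (fun k => n k - ∑ i ∈ Finset.Ioc k (m - 1), (p i).natDegree)
      (Q * ∏ i ∈ Finset.range m, p i) := by
  have hwc : ∀ k < m, Continuous (w' k) := fun k hk => by
    have : w' k = fun x => w k x * (p k).eval (x : ℂ) := funext (hw' k)
    rw [this]
    exact (hw k hk).mul ((p k).continuous.comp Complex.continuous_ofReal)
  intro k hk ν hν
  dsimp only at hν
  obtain ⟨l, hl, hlx⟩ := exists_prod_mul_nikD S hw p hw' k 0 (by omega)
  simp only [zero_add] at hl hlx
  have := S.hfin 0 (by omega)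
  have hc := S.hcpt 0 (by omega)
  set T := ∏ i ∈ Finset.Ioc k (m - 1), p i with hT
  have hTd : T.natDegree ≤ ∑ i ∈ Finset.Ioc k (m - 1), (p i).natDegree := natDegree_prod_le _ _
  have hsplit : ∏ i ∈ Finset.range m, p i = (∏ j ∈ Finset.Icc 0 k, p j) * T := by
    rw [hT, ← Finset.prod_union]
    · refine Finset.prod_congr ?_ fun _ _ => rfl
      ext j
      simp only [Finset.mem_union, Finset.mem_Icc, Finset.mem_Ioc, Finset.mem_range]
      omega
    · rw [Finset.disjoint_left]
      intro j
      simp only [Finset.mem_Icc, Finset.mem_Ioc]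
      omega
  have hi : ∀ i < m, ∀ f : Polynomial ℂ,
      Integrable (fun x : ℝ => f.eval (x : ℂ) * nikD S.μ w' 0 i x) (S.μ 0) := fun i hi f =>
    ((BddOnHull.of_polynomial f).mul (bddOnHull_nikD S hwc i 0 (by omega))).integrable hc
  have hexp : nikInt S.μ w k
        (fun x => (x : ℂ) ^ ν * (Q * ∏ i ∈ Finset.range m, p i).eval (x : ℂ)) =
      ∑ i ∈ Finset.range k, nikInt S.μ w' i (fun x => ((X ^ ν * T * l i) * Q).eval (x : ℂ)) +
        nikInt S.μ w' k (fun x => ((X ^ ν * T) * Q).eval (x : ℂ)) := by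
    simp only [nikInt]
    have hi' : ∀ i ∈ Finset.range k, Integrable (fun x : ℝ =>
        ((X ^ ν * T * l i) * Q).eval (x : ℂ) * nikD S.μ w' 0 i x) (S.μ 0) := fun i h =>
      hi i ((Finset.mem_range.1 h).trans hk) _
    rw [← integral_finsetSum _ hi', ← integral_add (integrable_finsetSum _ hi') (hi k hk _)]
    refine integral_congr_ae ?_
    filter_upwards [ae_mem_ihull hc] with x hx
    have h := hlx x hx
    have hfac : ∑ i ∈ Finset.range k,
        ((X ^ ν * T * l i) * Q).eval (x : ℂ) * nikD S.μ w' 0 i x =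
        ((x : ℂ) ^ ν * T.eval (x : ℂ) * Q.eval (x : ℂ)) *
          ∑ i ∈ Finset.range k, (l i).eval (x : ℂ) * nikD S.μ w' 0 i x := by
      rw [Finset.mul_sum]
      refine Finset.sum_congr rfl fun i _ => ?_
      simp only [eval_mul, eval_pow, eval_X]
      ring
    rw [hfac, hsplit]
    simp only [eval_mul, eval_pow, eval_X]
    linear_combination ((x : ℂ) ^ ν * T.eval (x : ℂ) * Q.eval (x : ℂ)) * h
  have hdeg : (X ^ ν * T).natDegree ≤ ν + ∑ i ∈ Finset.Ioc k (m - 1), (p i).natDegree :=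
    natDegree_mul_le.trans (add_le_add (natDegree_X_pow_le ν) hTd)
  rw [hexp, hQ.nikInt_mul_eq_zero hwc hk, add_zero]
  · refine Finset.sum_eq_zero fun i hik => ?_
    rw [Finset.mem_range] at hik
    refine hQ.nikInt_mul_eq_zero hwc (hik.trans hk) ?_
    by_cases h0 : l i = 0
    · simp [h0]
    · have h1 := mem_degreeLT.1 (hl i hik)
      rw [← natDegree_lt_iff_degree_lt h0] at h1
      have h2 := hn.2 i k hik hk
      have h3 : (X ^ ν * T * l i).natDegree < n i :=
        natDegree_mul_le.trans_lt (by omega)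
      exact mem_degreeLT.2 (degree_le_natDegree.trans_lt (by exact_mod_cast h3))
  · have h3 : (X ^ ν * T).natDegree < n k := by omega
    exact mem_degreeLT.2 (degree_le_natDegree.trans_lt (by exact_mod_cast h3))

/-- A polynomial of a subspace which has no nonzero element of degree less than `M` is a combination
of monic elements of degrees `M, M + 1, …`. -/
lemma exists_eq_sum_of_monic {V : Submodule ℂ (Polynomial ℂ)} {M : ℕ}
    (hV : ∀ f ∈ V, f ≠ 0 → M ≤ f.natDegree) (q : ℕ → Polynomial ℂ) (N : ℕ)
    (hq : ∀ j < N, q j ∈ V ∧ (q j).Monic ∧ (q j).natDegree = M + j) :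
    ∀ f ∈ V, f ∈ degreeLT ℂ (M + N) → ∃ c : ℕ → ℂ, (∀ j, N ≤ j → c j = 0) ∧
      f = ∑ j ∈ Finset.range N, c j • q j := by
  induction N with
  | zero =>
    intro f hf hfd
    refine ⟨0, fun _ _ => rfl, ?_⟩
    by_contra h0
    have h0' : f ≠ 0 := by simpa using h0
    have h1 := mem_degreeLT.1 hfd
    rw [← natDegree_lt_iff_degree_lt h0'] at h1
    have := hV f hf h0'
    omega
  | succ N ih =>
    intro f hf hfd
    obtain ⟨hqV, hqm, hqd⟩ := hq N (Nat.lt_succ_self N)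
    obtain ⟨c, hc, hfc⟩ := ih (fun j hj => hq j (by omega)) (f - f.coeff (M + N) • q N)
      (V.sub_mem hf (V.smul_mem _ hqV)) (by
        rw [mem_degreeLT, degree_lt_iff_coeff_zero]
        intro i hi
        rcases hi.eq_or_lt with rfl | hi
        · have : (q N).coeff (M + N) = 1 := by rw [← hqd]; exact hqm
          simp [this]
        · rw [mem_degreeLT, degree_lt_iff_coeff_zero] at hfd
          rw [coeff_sub, coeff_smul, hfd i (by omega),
            coeff_eq_zero_of_natDegree_lt (by omega : (q N).natDegree < i)]
          simp)
    refine ⟨Function.update c N (f.coeff (M + N)), fun j hj => ?_, ?_⟩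
    · rw [Function.update_of_ne (by omega), hc j (by omega)]
    · rw [Finset.sum_range_succ, Function.update_self]
      rw [sub_eq_iff_eq_add] at hfc
      conv_lhs => rw [hfc]
      congr 1
      refine Finset.sum_congr rfl fun j hj => ?_
      rw [Finset.mem_range] at hj
      rw [Function.update_of_ne (by omega)]

/-- The coefficients of a combination of monic polynomials of degrees `M, M + 1, …` beyond
the degree of the sum vanish. -/
lemma coeff_eq_zero_of_sum_monic {q : ℕ → Polynomial ℂ} {M N : ℕ}
    (hq : ∀ j < N, (q j).Monic ∧ (q j).natDegree = M + j) {c : ℕ → ℂ} {d : ℕ}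
    (h : ∑ j ∈ Finset.range N, c j • q j ∈ degreeLT ℂ (M + d)) :
    ∀ j < N, d ≤ j → c j = 0 := by
  induction N with
  | zero => exact fun j hj => absurd hj (Nat.not_lt_zero j)
  | succ N ih =>
    rcases le_or_gt d N with hd | hd
    · have hcN : c N = 0 := by
        have h1 := (degree_lt_iff_coeff_zero _ _).1 (mem_degreeLT.1 h) (M + N) (by omega)
        rw [Finset.sum_range_succ, coeff_add, finsetSum_coeff, Finset.sum_eq_zero, zero_add,
          coeff_smul] at h1
        · have : (q N).coeff (M + N) = 1 := by
            rw [← (hq N (Nat.lt_succ_self N)).2]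
            exact (hq N (Nat.lt_succ_self N)).1
          simpa [this] using h1
        · intro j hj
          rw [Finset.mem_range] at hj
          rw [coeff_smul, coeff_eq_zero_of_natDegree_lt
            (by have := (hq j (by omega)).2; omega), smul_zero]
      rw [Finset.sum_range_succ, hcN, zero_smul, add_zero] at h
      intro j hj hdj
      rcases (Nat.lt_succ_iff.1 hj).eq_or_lt with rfl | hj
      · exact hcN
      · exact ih (fun j hj => hq j (by omega)) h j hj hdj
    · intro j hj hdj
      omega

/-- If the coefficients beyond a given index vanish, the coefficient at that index of a combination of monic
polynomials of degrees `M, M + 1, …` is a coefficient of the sum. -/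
lemma coeff_sum_monic {q : ℕ → Polynomial ℂ} {M N : ℕ}
    (hq : ∀ j < N, (q j).Monic ∧ (q j).natDegree = M + j) {c : ℕ → ℂ} {j' : ℕ} (hj' : j' < N)
    (hc : ∀ j < N, j' < j → c j = 0) :
    (∑ j ∈ Finset.range N, c j • q j).coeff (M + j') = c j' := by
  rw [finsetSum_coeff, Finset.sum_eq_single_of_mem j' (Finset.mem_range.2 hj')]
  · have : (q j').coeff (M + j') = 1 := by
      rw [← (hq j' hj').2]
      exact (hq j' hj').1
    simp [this]
  · intro j hj hne
    rw [Finset.mem_range] at hj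
    rcases lt_or_gt_of_ne hne with h | h
    · rw [coeff_smul, coeff_eq_zero_of_natDegree_lt
        (by have := (hq j hj).2; omega), smul_zero]
    · simp [hc j hj h]

/-- Summation by parts for the degrees of the perturbing polynomials. -/
lemma sum_sum_Ioc (m : ℕ) (d : ℕ → ℕ) :
    ∑ k ∈ Finset.range m, (k + 1) * d k =
      ∑ k ∈ Finset.range m, ∑ i ∈ Finset.Ioc k (m - 1), d i + ∑ k ∈ Finset.range m, d k := by
  have h : ∀ k, ∑ i ∈ Finset.Ioc k (m - 1), d i =
      ∑ i ∈ Finset.range m, if k < i then d i else 0 := fun k => by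
    rw [← Finset.sum_filter]
    refine Finset.sum_congr ?_ fun _ _ => rfl
    ext i
    simp only [Finset.mem_Ioc, Finset.mem_filter, Finset.mem_range]
    omega
  simp_rw [h]
  rw [Finset.sum_comm, ← Finset.sum_add_distrib]
  refine Finset.sum_congr rfl fun i hi => ?_
  rw [Finset.mem_range] at hi
  rw [← Finset.sum_filter, Finset.sum_const, smul_eq_mul, add_mul, one_mul]
  congr 2
  have : (Finset.range m).filter (fun k => k < i) = Finset.range i := by
    ext k
    simp only [Finset.mem_filter, Finset.mem_range]
    omega
  rw [this, Finset.card_range]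

/-- `R_n = Q̃_n (p₁⋯p_m)` is a unique linear combination of the
multiple orthogonal polynomials `Q_{n_j}`, `j = 0,…,N`, `N = deg(p₁ p₂² ⋯ p_m^m)`; if
`deg R_n = deg Q_{n_{j'}}` then `λ_{j'} = 1` and `λ_j = 0` for `j > j'`; in particular
`λ_N = 1 ↔ deg Q̃_n = |n|`. -/
theorem perturbed_MOP_linear_combination
    (m : ℕ) (hm : 0 < m) (S : NikSys m) (p : ℕ → Polynomial ℂ) (hp : GoodPolys m S p)
    (n : ℕ → ℕ) (hn : StarIdx m p n)
    (hge : ∀ k < m, ∑ i ∈ Finset.Ioc k (m - 1), (p i).natDegree ≤ n k)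
    (Qt : Polynomial ℂ) (hQt : IsLeastMOP S.μ (polyW S p) m n Qt)
    (N : ℕ) (hN : N = ∑ k ∈ Finset.range m, (k + 1) * (p k).natDegree)
    (nj : ℕ → ℕ → ℕ)
    (hnj : ∀ j k : ℕ, nj j k =
      (if k = 0 then n 0 + j else n k) - ∑ i ∈ Finset.Ioc k (m - 1), (p i).natDegree)
    (Qj : ℕ → Polynomial ℂ)
    (hQj : ∀ j ≤ N, IsLeastMOP S.μ S.w m (nj j) (Qj j) ∧
      (Qj j).natDegree = mnorm m (nj j)) :
    (∃! c : ℕ → ℂ, (∀ j : ℕ, N < j → c j = 0) ∧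
        Qt * ∏ i ∈ Finset.range m, p i = ∑ j ∈ Finset.range (N + 1), c j • Qj j) ∧
      ∀ c : ℕ → ℂ, (∀ j : ℕ, N < j → c j = 0) →
        Qt * ∏ i ∈ Finset.range m, p i = ∑ j ∈ Finset.range (N + 1), c j • Qj j →
        (∀ j' ≤ N,
          (Qt * ∏ i ∈ Finset.range m, p i).natDegree = (Qj j').natDegree →
            c j' = 1 ∧ ∀ j ≤ N, j' < j → c j = 0) ∧
        (c N = 1 ↔ Qt.natDegree = mnorm m n) := by
  have hwc : ∀ k < m, Continuous (S.w k) := fun k _ => continuous_const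
  have hwp : ∀ k < m, Continuous (polyW S p k) := fun k _ =>
    continuous_const.mul ((p k).continuous.comp Complex.continuous_ofReal)
  set P := ∏ i ∈ Finset.range m, p i with hP
  set R := Qt * P with hR
  have hPm : P.Monic := monic_prod_of_monic _ _ fun i hi => hp.1 i (Finset.mem_range.1 hi)
  have hPd : P.natDegree = ∑ k ∈ Finset.range m, (p k).natDegree :=
    natDegree_prod_of_monic _ _ fun i hi => hp.1 i (Finset.mem_range.1 hi)
  have hRm : R.Monic := hQt.1.mul hPm
  have hRd : R.natDegree = Qt.natDegree + P.natDegree := hQt.1.natDegree_mul hPm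
  have hQtd : Qt.natDegree ≤ mnorm m n := hQt.natDegree_le hwp
  have hnorm0 : mnorm m (nj 0) +
      ∑ k ∈ Finset.range m, ∑ i ∈ Finset.Ioc k (m - 1), (p i).natDegree = mnorm m n := by
    rw [mnorm, mnorm, ← Finset.sum_add_distrib]
    refine Finset.sum_congr rfl fun k hk => ?_
    have := hge k (Finset.mem_range.1 hk)
    rw [hnj]
    split_ifs with h
    · subst h
      omega
    · omega
  have hnormj : ∀ j, mnorm m (nj j) = mnorm m (nj 0) + j := fun j => by
    obtain ⟨m, rfl⟩ := Nat.exists_eq_succ_of_ne_zero hm.ne'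
    have := hge 0 hm
    simp only [mnorm, Finset.sum_range_succ', hnj, Nat.succ_ne_zero, if_false, if_true]
    omega
  have hMN : mnorm m (nj 0) + N = mnorm m n + P.natDegree := by
    rw [hN, sum_sum_Ioc, hPd]
    omega
  obtain ⟨V, hV⟩ := exists_submodule_orthRel S hwc (nj 0)
  have hRV : R ∈ V := by
    rw [hV]
    refine (hQt.2.1.mul_prod hwc (w' := polyW S p) (fun _ _ => rfl) hn).mono fun k => ?_
    rw [hnj]
    split_ifs with h
    · subst h
      simp
    · exact le_rfl
  have hq : ∀ j < N + 1, (Qj j).Monic ∧ (Qj j).natDegree = mnorm m (nj 0) + j := fun j hj =>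
    ⟨(hQj j (by omega)).1.1, by rw [(hQj j (by omega)).2, hnormj]⟩
  have hqV : ∀ j < N + 1, Qj j ∈ V := fun j hj => by
    rw [hV]
    refine (hQj j (by omega)).1.2.1.mono fun k => ?_
    rw [hnj, hnj]
    split_ifs <;> omega
  have hVd : ∀ f ∈ V, f ≠ 0 → mnorm m (nj 0) ≤ f.natDegree := by
    intro f hf hf0
    rw [← (hQj 0 (Nat.zero_le N)).2]
    refine ((hQj 0 (Nat.zero_le N)).1.2.2 (C f.leadingCoeff⁻¹ * f) ?_ ((hV _).1 ?_)).trans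
      (natDegree_C_mul_le _ _)
    · rw [mul_comm]
      exact monic_mul_leadingCoeff_inv hf0
    · rw [← smul_eq_C_mul]
      exact V.smul_mem _ hf
  have hdegLT : ∀ (f : Polynomial ℂ) (d : ℕ), f.natDegree < d → f ∈ degreeLT ℂ d :=
    fun f d h => mem_degreeLT.2 (degree_le_natDegree.trans_lt (by exact_mod_cast h))
  refine ⟨?_, fun c _ hcR => ⟨fun j' hj' hd => ?_, ?_⟩⟩
  · obtain ⟨c, hc, hcR⟩ := exists_eq_sum_of_monic hVd Qj (N + 1)
      (fun j hj => ⟨hqV j hj, hq j hj⟩) R hRV (hdegLT _ _ (by omega))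
    refine ⟨c, ⟨fun j hj => hc j hj, hcR⟩, fun c' ⟨hc', hcR'⟩ => ?_⟩
    have h0 : ∑ j ∈ Finset.range (N + 1), (c' - c) j • Qj j ∈ degreeLT ℂ (mnorm m (nj 0) + 0) := by
      simp only [Pi.sub_apply, sub_smul, Finset.sum_sub_distrib]
      rw [← hcR, ← hcR', sub_self]
      exact Submodule.zero_mem _
    funext j
    rcases Nat.lt_or_ge j (N + 1) with hj | hj
    · exact sub_eq_zero.1 (coeff_eq_zero_of_sum_monic hq h0 j hj (Nat.zero_le j))
    · rw [hc j hj, hc' j hj]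
  · have hdR := hd.trans (hq j' (by omega)).2
    have hz : ∀ j < N + 1, j' < j → c j = 0 := fun j hj hlt =>
      coeff_eq_zero_of_sum_monic hq (hcR ▸ hdegLT R (mnorm m (nj 0) + (j' + 1)) (by omega))
        j hj hlt
    refine ⟨?_, fun j hj => hz j (by omega)⟩
    rw [← coeff_sum_monic hq (by omega : j' < N + 1) hz, ← hcR, ← hdR]
    exact hRm
  · have hcN : R.coeff (mnorm m (nj 0) + N) = c N := by
      rw [hcR]
      exact coeff_sum_monic hq (Nat.lt_succ_self N) fun j hj hlt => by omega
    constructor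
    · intro h
      have := le_natDegree_of_ne_zero (hcN.trans h ▸ one_ne_zero)
      omega
    · intro h
      rw [← hcN, hMN, ← h, ← hRd]
      exact hRm
end
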